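/- Let L=(T,V,E) be a link stream, let t < t' in T, and suppose that the graph G_s is one and the same graph G for every s ∈ ]t,t'[. Let x,w ∈ V be connected in G, let d be the graph distance from x to w in G, and let σ be the number of shortest paths from x to w in G. Identify each sequence v₀,t₁,v₁,…,t_d,v_d with the pair ((v₀,…,v_d),(t₁,…,t_d)) ∈ V^{d+1} × ℝ^d. Then the set of paths from (t,x) to (t',w) in L whose times all lie in ]t,t'[ and which have minimal length among such paths has measure σ·(t'−t)^d/d! with respect to the product of the counting measure on V^{d+1} and the d-dimensional Lebesgue measure on ℝ^d. -/

import Mathlib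

/-!
Common definitions: link streams, paths, distances, latency pairs, etc.
-/

/-- A link stream `L = (T,V,E)` with `T = [tmin, tmax]` an interval of `ℝ`,
nodes `V`, and links `E ⊆ T × (V ⊗ V)` (unordered pairs of distinct nodes). -/
structure LinkStream (V : Type*) where
  tmin : ℝ
  tmax : ℝ
  hminmax : tmin ≤ tmax
  E : Set (ℝ × Sym2 V)
  hT : ∀ p ∈ E, p.1 ∈ Set.Icc tmin tmax
  hND : ∀ p ∈ E, ¬ p.2.IsDiag

/-- starting time of a path of length `k ≥ 1` given by its times (junk value for `k = 0`). -/
noncomputable def startT {k : ℕ} (times : Fin k → ℝ) : ℝ :=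
  if h : 0 < k then times ⟨0, h⟩ else 0

/-- arrival time of a path of length `k ≥ 1` given by its times (junk value for `k = 0`). -/
noncomputable def arrT {k : ℕ} (times : Fin k → ℝ) : ℝ :=
  if _ : 0 < k then times ⟨k - 1, by omega⟩ else 0

/-- The path `v₀,t₁,v₁,…,t_k,v_k` involves `(t,v)`. -/
def Involves {V : Type*} {k : ℕ} (nodes : Fin (k + 1) → V) (times : Fin k → ℝ)
    (t : ℝ) (v : V) : Prop :=
  (∃ i : ℕ, ∃ _ : 1 ≤ i, ∃ _ : i + 1 ≤ k,
     v = nodes ⟨i, by omega⟩ ∧ times ⟨i - 1, by omega⟩ ≤ t ∧ t ≤ times ⟨i, by omega⟩) ∨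
  (∃ h : 1 ≤ k, v = nodes 0 ∧ t = times ⟨0, h⟩) ∨
  (∃ h : 1 ≤ k, v = nodes (Fin.last k) ∧ t = times ⟨k - 1, by omega⟩)

/-- `A` is a finite union of pairwise disjoint closed intervals (possibly singletons). -/
def FiniteClosedUnion (A : Set ℝ) : Prop :=
  ∃ S : Finset (ℝ × ℝ), (∀ p ∈ S, p.1 ≤ p.2) ∧
    (A = ⋃ p ∈ S, Set.Icc p.1 p.2) ∧
    (S : Set (ℝ × ℝ)).Pairwise fun p q => Disjoint (Set.Icc p.1 p.2) (Set.Icc q.1 q.2)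

namespace LinkStream

variable {V : Type*}

/-- `T_uv`: the set of time instants at which `u` and `v` are linked. -/
def Tuv (L : LinkStream V) (u v : V) : Set ℝ := {t | (t, s(u, v)) ∈ L.E}

/-- `G_t`: the graph at time `t`. -/
def Gt (L : LinkStream V) (t : ℝ) : SimpleGraph V where
  Adj u v := (t, s(u, v)) ∈ L.E
  symm := ⟨fun u v h => by change (t, s(v, u)) ∈ L.E; rwa [Sym2.eq_swap]⟩
  loopless := ⟨fun u h => L.hND _ h (by simp)⟩

/-- `(nodes, times)` is a path of length `k` from `(x,u)` to `(y,w)` in `L`. -/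
def IsPathOn (L : LinkStream V) (x : ℝ) (u : V) (y : ℝ) (w : V) (k : ℕ)
    (nodes : Fin (k + 1) → V) (times : Fin k → ℝ) : Prop :=
  nodes 0 = u ∧ nodes (Fin.last k) = w ∧ x ≤ y ∧
  (∀ m, x ≤ times m ∧ times m ≤ y) ∧
  (∀ m m' : Fin k, m ≤ m' → times m ≤ times m') ∧
  (∀ m : Fin k, (times m, s(nodes m.castSucc, nodes m.succ)) ∈ L.E)

/-- `(y,w)` is reachable from `(x,u)`, written `(x,u) ⟶ (y,w)`. -/
def Reach (L : LinkStream V) (x : ℝ) (u : V) (y : ℝ) (w : V) : Prop :=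
  ∃ k nodes times, L.IsPathOn x u y w k nodes times

/-- the distance `d((x,u),(y,w))`: minimal length of a path (junk value `0` if unreachable). -/
noncomputable def dist (L : LinkStream V) (x : ℝ) (u : V) (y : ℝ) (w : V) : ℕ :=
  sInf {k | ∃ nodes times, L.IsPathOn x u y w k nodes times}

/-- `(nodes, times)` is a shortest path from `(x,u)` to `(y,w)`. -/
def IsShortest (L : LinkStream V) (x : ℝ) (u : V) (y : ℝ) (w : V) (k : ℕ)
    (nodes : Fin (k + 1) → V) (times : Fin k → ℝ) : Prop :=
  L.IsPathOn x u y w k nodes times ∧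
  ∀ k' nodes' times', L.IsPathOn x u y w k' nodes' times' → k ≤ k'

/-- `(s,a)` is a latency pair from `u` to `w`. -/
def IsLatencyPair (L : LinkStream V) (u w : V) (s a : ℝ) : Prop :=
  s ∈ Set.Icc L.tmin L.tmax ∧ a ∈ Set.Icc L.tmin L.tmax ∧ s ≤ a ∧
  (∃ k nodes times, 1 ≤ k ∧ L.IsPathOn s u a w k nodes times) ∧
  (∀ k nodes (times : Fin k → ℝ), 1 ≤ k → L.IsPathOn s u a w k nodes times →
     startT times = s ∧ arrT times = a)

/-- `(nodes, times)` is a fastest path from `(i,u)` to `(j,w)`: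
a path of minimal duration among all (length ≥ 1) paths from `(i,u)` to `(j,w)`. -/
def IsFastest (L : LinkStream V) (i : ℝ) (u : V) (j : ℝ) (w : V) (k : ℕ)
    (nodes : Fin (k + 1) → V) (times : Fin k → ℝ) : Prop :=
  1 ≤ k ∧ L.IsPathOn i u j w k nodes times ∧
  ∀ k' (nodes' : Fin (k' + 1) → V) (times' : Fin k' → ℝ), 1 ≤ k' →
    L.IsPathOn i u j w k' nodes' times' →
    arrT times - startT times ≤ arrT times' - startT times'

/-- `(nodes, times)` is a shortest fastest path from `(i,u)` to `(j,w)`. -/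
def IsSFP (L : LinkStream V) (i : ℝ) (u : V) (j : ℝ) (w : V) (k : ℕ)
    (nodes : Fin (k + 1) → V) (times : Fin k → ℝ) : Prop :=
  L.IsFastest i u j w k nodes times ∧
  ∀ k' nodes' times', L.IsFastest i u j w k' nodes' times' → k ≤ k'

/-- a path from `(t,x)` to `(t',w)` whose times all lie in `]t,t'[`. -/
def IsPathIoo (L : LinkStream V) (t : ℝ) (x : V) (t' : ℝ) (w : V) (k : ℕ)
    (nodes : Fin (k + 1) → V) (times : Fin k → ℝ) : Prop :=
  L.IsPathOn t x t' w k nodes times ∧ ∀ m, times m ∈ Set.Ioo t t'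

/-- a path from `(t,x)` to `(t',w)` with all times in `]t,t'[`, of minimal length
among all such paths. -/
def IsMinPathIoo (L : LinkStream V) (t : ℝ) (x : V) (t' : ℝ) (w : V) (k : ℕ)
    (nodes : Fin (k + 1) → V) (times : Fin k → ℝ) : Prop :=
  L.IsPathIoo t x t' w k nodes times ∧
  ∀ k' nodes' times', L.IsPathIoo t x t' w k' nodes' times' → k ≤ k'

/-- `t` is an event time: an endpoint of a maximal interval of some `T_uv`. -/
def IsEventTime (L : LinkStream V) (t : ℝ) : Prop :=
  ∃ u v b e, b ≤ e ∧ Set.Icc b e ⊆ L.Tuv u v ∧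
    (∀ b' e', b' ≤ b → e ≤ e' → Set.Icc b' e' ⊆ L.Tuv u v → b' = b ∧ e' = e) ∧
    (t = b ∨ t = e)

end LinkStream

/-- A tuple in `[a, b]` is nondecreasing if and only if its tail is nondecreasing and bounded below
by its head. -/
theorem monotone_cons_and_forall_mem_Icc_iff {α : Type*} [Preorder α] {n : ℕ} {a b : α} (s : α)
    (f : Fin n → α) :
    (Monotone (Fin.cons s f : Fin (n + 1) → α) ∧
        ∀ i, (Fin.cons s f : Fin (n + 1) → α) i ∈ Set.Icc a b) ↔
      s ∈ Set.Icc a b ∧ Monotone f ∧ ∀ i, f i ∈ Set.Icc s b := by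
  simp only [Fin.forall_fin_succ, Fin.cons_zero, Fin.cons_succ]
  constructor
  · rintro ⟨hm, hs, h⟩
    refine ⟨hs, fun i j hij => ?_, fun i => ⟨?_, (h i).2⟩⟩
    · simpa using hm (Fin.succ_le_succ_iff.2 hij)
    · simpa using hm (Fin.zero_le i.succ)
  · rintro ⟨hs, hm, h⟩
    refine ⟨fun i j => ?_, hs, fun i => ⟨hs.1.trans (h i).1, (h i).2⟩⟩
    refine Fin.cases ?_ (fun i => ?_) i <;> refine Fin.cases ?_ (fun j => ?_) j <;> intro hij
    · simp
    · simpa using (h j).1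
    · simp at hij
    · simpa using hm (Fin.succ_le_succ_iff.1 hij)

open MeasureTheory in
/-- The nondecreasing `n`-tuples in `[a, b]` have volume `(b - a) ^ n / n!`. -/
theorem volume_monotone_Icc (n : ℕ) (a b : ℝ) (hab : a ≤ b) :
    volume {f : Fin n → ℝ | Monotone f ∧ ∀ i, f i ∈ Set.Icc a b} =
      ENNReal.ofReal ((b - a) ^ n / n.factorial) := by
  have hmeas : ∀ (m : ℕ) (a : ℝ),
      MeasurableSet {f : Fin m → ℝ | Monotone f ∧ ∀ i, f i ∈ Set.Icc a b} := by
    intro m a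
    refine MeasurableSet.inter isClosed_monotone.measurableSet ?_
    exact (MeasurableSet.univ_pi fun _ : Fin m => measurableSet_Icc (a := a) (b := b)).congr
      (by ext f; simp only [Set.mem_univ_pi]; rfl)
  induction n generalizing a with
  | zero =>
    have : {f : Fin 0 → ℝ | Monotone f ∧ ∀ i, f i ∈ Set.Icc a b} = Set.univ := by
      ext f
      simp [Subsingleton.monotone f]
    rw [this, volume_pi, Measure.pi_of_empty]
    simp
  | succ n ih =>
    have hmp := (volume_preserving_piFinSuccAbove (fun _ : Fin (n + 1) => ℝ) 0).symm
    rw [← hmp.measure_preimage (hmeas (n + 1) a).nullMeasurableSet, Measure.volume_eq_prod,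
      Measure.prod_apply (hmp.measurable (hmeas (n + 1) a))]
    have hmem : ∀ (s : ℝ) (f : Fin n → ℝ),
        (MeasurableEquiv.piFinSuccAbove (fun _ : Fin (n + 1) => ℝ) 0).symm (s, f) ∈
            {f : Fin (n + 1) → ℝ | Monotone f ∧ ∀ i, f i ∈ Set.Icc a b} ↔
          s ∈ Set.Icc a b ∧ Monotone f ∧ ∀ i, f i ∈ Set.Icc s b := by
      intro s f
      have hcons : (MeasurableEquiv.piFinSuccAbove (fun _ : Fin (n + 1) => ℝ) 0).symm (s, f) =
          (Fin.cons s f : Fin (n + 1) → ℝ) := Fin.insertNth_zero' s f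
      rw [hcons]
      exact monotone_cons_and_forall_mem_Icc_iff s f
    have hslice : ∀ s : ℝ, volume (Prod.mk s ⁻¹'
        ((MeasurableEquiv.piFinSuccAbove (fun _ : Fin (n + 1) => ℝ) 0).symm ⁻¹'
          {f : Fin (n + 1) → ℝ | Monotone f ∧ ∀ i, f i ∈ Set.Icc a b})) =
        (Set.Icc a b).indicator (fun s => ENNReal.ofReal ((b - s) ^ n / n.factorial)) s := by
      intro s
      by_cases hs : s ∈ Set.Icc a b
      · rw [Set.indicator_of_mem hs, ← ih s hs.2]
        congr 1
        ext f
        exact (hmem s f).trans (and_iff_right hs)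
      · rw [Set.indicator_of_notMem hs, ← measure_empty (μ := (volume : Measure (Fin n → ℝ)))]
        congr 1
        ext f
        exact (hmem s f).trans (iff_of_false (fun h => hs h.1) id)
    simp_rw [hslice]
    rw [lintegral_indicator measurableSet_Icc, ← ofReal_integral_eq_lintegral_ofReal]
    · rw [integral_Icc_eq_integral_Ioc, ← intervalIntegral.integral_of_le hab,
        intervalIntegral.integral_div,
        intervalIntegral.integral_comp_sub_left (fun s => s ^ n) b, integral_pow]
      congr 1
      rw [Nat.factorial_succ]
      push_cast
      field_simp
      simp
    · exact (Continuous.integrableOn_Icc (by fun_prop))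
    · filter_upwards [ae_restrict_mem measurableSet_Icc] with s hs
      have := sub_nonneg.2 hs.2
      simp only [Pi.zero_apply]
      positivity

open MeasureTheory in
/-- The nondecreasing `n`-tuples in `]a, b[` have volume `(b - a) ^ n / n!`. -/
theorem volume_monotone_Ioo (n : ℕ) (a b : ℝ) (hab : a ≤ b) :
    volume {f : Fin n → ℝ | Monotone f ∧ ∀ i, f i ∈ Set.Ioo a b} =
      ENNReal.ofReal ((b - a) ^ n / n.factorial) := by
  rw [← volume_monotone_Icc n a b hab]
  have h := (Measure.univ_pi_Ioo_ae_eq_Icc (μ := fun _ : Fin n => (volume : Measure ℝ))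
    (f := fun _ => a) (g := fun _ => b))
  have h2 := measure_congr
    ((Filter.EventuallyEq.refl (ae volume) {f : Fin n → ℝ | Monotone f}).inter h)
  convert h2 using 2
  · ext f
    simp [Set.mem_pi]
  · ext f
    simp [Set.mem_Icc, Pi.le_def, forall_and]

namespace SimpleGraph

variable {V : Type*} {G : SimpleGraph V}

/-- A sequence of successively adjacent vertices is the vertex sequence of a walk. -/
theorem exists_walk_getVert_eq (k : ℕ) (nodes : Fin (k + 1) → V)
    (h : ∀ m : Fin k, G.Adj (nodes m.castSucc) (nodes m.succ)) :
    ∃ p : G.Walk (nodes 0) (nodes (Fin.last k)),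
      p.length = k ∧ ∀ i : Fin (k + 1), p.getVert i = nodes i := by
  induction k with
  | zero => exact ⟨.nil, rfl, fun i => congrArg nodes (Fin.fin_one_eq_zero i).symm⟩
  | succ k ih =>
    obtain ⟨p, hl, hp⟩ := ih (fun i => nodes i.succ) fun m => by simpa using h m.succ
    refine ⟨.cons (h 0) p, congrArg (· + 1) hl, fun i => ?_⟩
    refine Fin.cases ?_ (fun i => ?_) i
    · rfl
    · exact hp i

/-- A walk between connected vertices is a path of minimal length if and only if its length is
the distance between its endpoints. -/
theorem Walk.isPath_and_forall_length_le_iff {x w : V} (p : G.Walk x w) :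
    (p.IsPath ∧ ∀ q : G.Walk x w, q.IsPath → p.length ≤ q.length) ↔ p.length = G.dist x w := by
  constructor
  · rintro ⟨-, h⟩
    obtain ⟨q, hq, hql⟩ := p.reachable.exists_path_of_dist
    exact le_antisymm (hql ▸ h q hq) (dist_le p)
  · exact fun h => ⟨p.isPath_of_length_eq_dist h, fun q _ => h ▸ dist_le q⟩

/-- The walks of length `k` from `x` to `w` correspond to their sequences of vertices. -/
theorem card_walk_length_eq (x w : V) (k : ℕ) :
    Nat.card {p : G.Walk x w // p.length = k} =
      {nodes : Fin (k + 1) → V | nodes 0 = x ∧ nodes (Fin.last k) = w ∧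
        ∀ m : Fin k, G.Adj (nodes m.castSucc) (nodes m.succ)}.ncard := by
  rw [← Nat.card_coe_set_eq]
  refine Nat.card_congr (Equiv.ofBijective
    (fun p => ⟨fun i => p.1.getVert i, by simp, ?_, fun m => ?_⟩) ⟨?_, ?_⟩)
  · simp [← p.2]
  · exact p.1.adj_getVert_succ (by simp [p.2])
  · rintro ⟨p, hp⟩ ⟨q, hq⟩ h
    refine Subtype.ext (Walk.ext_getVert_le_length (hp.trans hq.symm) fun i hi => ?_)
    exact congrFun (congrArg Subtype.val h) ⟨i, Nat.lt_succ_of_le (hi.trans_eq hp)⟩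
  · rintro ⟨nodes, rfl, rfl, h⟩
    obtain ⟨p, hl, hp⟩ := exists_walk_getVert_eq k nodes h
    exact ⟨⟨p, hl⟩, Subtype.ext (funext hp)⟩

end SimpleGraph

namespace LinkStream

variable {V : Type*}

/-- When `G_s = G` throughout `]t, t'[`, a path with all times in `]t, t'[` is a walk of `G`
together with a nondecreasing tuple of times in `]t, t'[`. -/
theorem isPathIoo_iff (L : LinkStream V) {t t' : ℝ} (htt : t < t') {G : SimpleGraph V}
    (hG : ∀ s ∈ Set.Ioo t t', L.Gt s = G) (x w : V) {k : ℕ}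
    (nodes : Fin (k + 1) → V) (times : Fin k → ℝ) :
    L.IsPathIoo t x t' w k nodes times ↔
      (nodes 0 = x ∧ nodes (Fin.last k) = w ∧
        ∀ m : Fin k, G.Adj (nodes m.castSucc) (nodes m.succ)) ∧
      Monotone times ∧ ∀ m, times m ∈ Set.Ioo t t' := by
  have hE : (∀ m, times m ∈ Set.Ioo t t') → ∀ m u v, (times m, s(u, v)) ∈ L.E ↔ G.Adj u v :=
    fun h m u v => by rw [← hG _ (h m)]; rfl
  constructor
  · rintro ⟨⟨h0, hl, -, -, hm, he⟩, hI⟩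
    exact ⟨⟨h0, hl, fun m => (hE hI m _ _).1 (he m)⟩, fun i j => hm i j, hI⟩
  · rintro ⟨⟨h0, hl, he⟩, hm, hI⟩
    exact ⟨⟨h0, hl, htt.le, fun m => ⟨(hI m).1.le, (hI m).2.le⟩, fun i j h => hm h,
      fun m => (hE hI m _ _).2 (he m)⟩, hI⟩

end LinkStream

/-- if `G_s = G` for all `s ∈ ]t,t'[`, `x` and `w` are connected in `G` with
graph distance `d` and `σ` shortest paths between them, then the set of minimal-length
paths from `(t,x)` to `(t',w)` with all times in `]t,t'[`, seen as a subset of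
`V^{d+1} × ℝ^d`, has measure `σ·(t'−t)^d/d!` for the product of the counting measure
and the `d`-dimensional Lebesgue measure. -/
theorem volume_of_min_paths_Ioo {V : Type*} [Fintype V]
    [MeasurableSpace V] [MeasurableSingletonClass V]
    (L : LinkStream V) (t t' : ℝ)
    (ht : t ∈ Set.Icc L.tmin L.tmax) (ht' : t' ∈ Set.Icc L.tmin L.tmax) (htt : t < t')
    (G : SimpleGraph V) (hG : ∀ s ∈ Set.Ioo t t', L.Gt s = G)
    (x w : V) (hconn : G.Reachable x w)
    (d : ℕ) (hd : d = G.dist x w)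
    (σ : ℕ)
    (hσ : σ = Nat.card {p : G.Walk x w // p.IsPath ∧
      ∀ q : G.Walk x w, q.IsPath → p.length ≤ q.length}) :
    (MeasureTheory.Measure.prod
        (MeasureTheory.Measure.count : MeasureTheory.Measure (Fin (d + 1) → V))
        (MeasureTheory.volume : MeasureTheory.Measure (Fin d → ℝ)))
      {p : (Fin (d + 1) → V) × (Fin d → ℝ) | L.IsMinPathIoo t x t' w d p.1 p.2}
      = ENNReal.ofReal ((σ : ℝ) * (t' - t) ^ d / (Nat.factorial d)) := by
  have hset : {p : (Fin (d + 1) → V) × (Fin d → ℝ) | L.IsMinPathIoo t x t' w d p.1 p.2} =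
      {nodes : Fin (d + 1) → V | nodes 0 = x ∧ nodes (Fin.last d) = w ∧
        ∀ m : Fin d, G.Adj (nodes m.castSucc) (nodes m.succ)} ×ˢ
      {f : Fin d → ℝ | Monotone f ∧ ∀ i, f i ∈ Set.Ioo t t'} := by
    ext ⟨nodes, times⟩
    refine Iff.trans ?_ (L.isPathIoo_iff htt hG x w nodes times)
    refine ⟨fun h => h.1, fun h => ⟨h, fun k' nodes' times' h' => ?_⟩⟩
    obtain ⟨⟨rfl, rfl, hadj⟩, -⟩ := (L.isPathIoo_iff htt hG x w nodes' times').1 h'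
    obtain ⟨p, hl, -⟩ := SimpleGraph.exists_walk_getVert_eq k' nodes' hadj
    exact hd.trans_le ((SimpleGraph.dist_le p).trans_eq hl)
  simp_rw [SimpleGraph.Walk.isPath_and_forall_length_le_iff, ← hd,
    SimpleGraph.card_walk_length_eq] at hσ
  rw [hset, MeasureTheory.Measure.prod_prod, volume_monotone_Ioo d t t' htt.le,
    MeasureTheory.Measure.count_apply_finite _ (Set.toFinite _),
    ← Set.ncard_eq_toFinset_card, ← hσ, mul_div_assoc,
    ENNReal.ofReal_mul (Nat.cast_nonneg σ), ENNReal.ofReal_natCast]
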